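/- arXiv:2302.07937 — 8 statements merged into one kernel-verified Lean document; each statement's English description precedes it below -/
import Mathlib

section
/- Fix integers d, l ≥ 1. For Lebesgue-almost every choice of the frozen weight matrices W_1, …, W_{2l}, where W_i ∈ ℝ^{d²×d} for odd i and W_i ∈ ℝ^{d×d²} for even i, the following holds: for every target ReLU network g(x) = Γ*_l V_l σ(Γ*_{l−1} V_{l−1} σ(⋯ σ(Γ*_1 V_1 x + β*_1) ⋯) + β*_{l−1}) + β*_l, where each V_i ∈ ℝ^{d×d} satisfies ‖V_i‖ ≤ 1, each Γ*_i ∈ ℝ^{d×d} is diagonal, and each β*_i ∈ ℝ^d, there exist diagonal matrices Γ_1, …, Γ_{2l} (Γ_i ∈ ℝ^{d²×d²} for odd i, Γ_i ∈ ℝ^{d×d} for even i) and vectors β_1, …, β_{2l} (β_i ∈ ℝ^{d²} for odd i, β_i ∈ ℝ^{d} for even i) such that the network f(x) = Γ_{2l} W_{2l} σ(Γ_{2l−1} W_{2l−1} σ(⋯ σ(Γ_1 W_1 x + β_1) ⋯) + β_{2l−1}) + β_{2l} satisfies f(x) = g(x) for every x ∈ ℝ^d with ‖x‖ ≤ 1.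 -/
noncomputable section
open MeasureTheory Matrix

/-- The ReLU activation `σ(t) = max(t, 0)`. -/
def relu (t : ℝ) : ℝ := max t 0

/-- Entrywise ReLU on a vector. -/
def reluV {n : ℕ} (v : Fin n → ℝ) : Fin n → ℝ := fun i => relu (v i)

/-- Euclidean norm of a vector. -/
def eNorm {n : ℕ} (v : Fin n → ℝ) : ℝ := Real.sqrt (∑ i, v i ^ 2)

/-- Frobenius norm of a matrix. -/
def frob {n m : ℕ} (A : Matrix (Fin n) (Fin m) ℝ) : ℝ := Real.sqrt (∑ i, ∑ j, A i j ^ 2)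

/-- Iterated composition: `chain step k = step (k-1) ∘ ⋯ ∘ step 0`. -/
def chain {α : Type*} (step : ℕ → α → α) : ℕ → α → α
  | 0 => fun x => x
  | k + 1 => fun x => step k (chain step k x)

/-- Extend a `Fin l`-indexed family to a `ℕ`-indexed one (by `0` out of range). -/
def ext {l : ℕ} {α : Type*} [Zero α] (f : Fin l → α) : ℕ → α :=
  fun k => if h : k < l then f ⟨k, h⟩ else 0

/-- One affine layer `y ↦ Γ V y + β` of the target network (`Γ` diagonal). -/
def gLayer {d : ℕ} (Γ : Fin d → ℝ) (V : Matrix (Fin d) (Fin d) ℝ) (β : Fin d → ℝ)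
    (y : Fin d → ℝ) : Fin d → ℝ :=
  diagonal Γ *ᵥ (V *ᵥ y) + β

/-- The target network
`g(x) = Γ*_l V_l σ(Γ*_{l−1} V_{l−1} σ(⋯ σ(Γ*_1 V_1 x + β*_1) ⋯) + β*_{l−1}) + β*_l`. -/
def gNet (d l : ℕ) (Γ : ℕ → Fin d → ℝ) (V : ℕ → Matrix (Fin d) (Fin d) ℝ)
    (β : ℕ → Fin d → ℝ) (x : Fin d → ℝ) : Fin d → ℝ :=
  gLayer (Γ (l - 1)) (V (l - 1)) (β (l - 1))
    (chain (fun k y => reluV (gLayer (Γ k) (V k) (β k) y)) (l - 1) x)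

/-- A pair of consecutive layers (odd layer of width `d²`, followed by the even layer of
width `d`) of the random network: `y ↦ Γe We σ(Γo Wo y + βo) + βe`. -/
def fBlock {d : ℕ} (Γo βo : Fin (d * d) → ℝ) (Γe βe : Fin d → ℝ)
    (Wo : Matrix (Fin (d * d)) (Fin d) ℝ) (We : Matrix (Fin d) (Fin (d * d)) ℝ)
    (y : Fin d → ℝ) : Fin d → ℝ :=
  diagonal Γe *ᵥ (We *ᵥ reluV (diagonal Γo *ᵥ (Wo *ᵥ y) + βo)) + βe

/-- The `2l`-layer random network
`f(x) = Γ_{2l} W_{2l} σ(Γ_{2l−1} W_{2l−1} σ(⋯ σ(Γ_1 W_1 x + β_1) ⋯) + β_{2l−1}) + β_{2l}`,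
organized into `l` blocks of two layers each; a ReLU separates consecutive blocks and the
final (even) layer has no ReLU. -/
def fNet (d l : ℕ) (Γo βo : ℕ → Fin (d * d) → ℝ) (Γe βe : ℕ → Fin d → ℝ)
    (Wo : ℕ → Matrix (Fin (d * d)) (Fin d) ℝ) (We : ℕ → Matrix (Fin d) (Fin (d * d)) ℝ)
    (x : Fin d → ℝ) : Fin d → ℝ :=
  fBlock (Γo (l - 1)) (βo (l - 1)) (Γe (l - 1)) (βe (l - 1)) (Wo (l - 1)) (We (l - 1))
    (chain (fun k y => reluV (fBlock (Γo k) (βo k) (Γe k) (βe k) (Wo k) (We k) y)) (l - 1) x)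

/-- A real-analytic function which is not identically zero is nonzero almost everywhere. -/
theorem AnalyticOnNhd.ae_ne_zero {E : Type*} [NormedAddCommGroup E] [NormedSpace ℝ E]
    [FiniteDimensional ℝ E] [MeasurableSpace E] [BorelSpace E] {μ : Measure E}
    [μ.IsAddHaarMeasure] {f : E → ℝ} (hf : AnalyticOnNhd ℝ f Set.univ) {w : E} (hw : f w ≠ 0) :
    ∀ᵐ x ∂μ, f x ≠ 0 := by
  have hcont : Continuous f := hf.continuous
  have hline : ∀ᵐ x ∂μ, ∀ᵐ t : ℝ, f (AffineMap.homothety w t x) ≠ 0 := by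
    refine .of_forall fun x => ?_
    have hg : AnalyticOnNhd ℝ (fun t : ℝ => f (AffineMap.homothety w t x)) Set.univ := by
      intro t _
      refine (hf _ (Set.mem_univ _)).fun_comp ?_
      simp only [AffineMap.homothety_apply, vsub_eq_sub, vadd_eq_add]
      fun_prop
    have hcod := hg.preimage_zero_mem_codiscrete (x := 0) (by simpa using hw)
    have hae := ae_restrict_le_codiscreteWithin (μ := volume) MeasurableSet.univ hcod
    rw [Measure.restrict_univ] at hae
    filter_upwards [hae] with t ht using ht
  have hmeas : MeasurableSet {p : E × ℝ | f (AffineMap.homothety w p.2 p.1) ≠ 0} := by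
    simp only [AffineMap.homothety_apply, vsub_eq_sub, vadd_eq_add]
    exact (isOpen_ne_fun (by fun_prop) continuous_const).measurableSet
  obtain ⟨t, ht, ht0⟩ := (((Measure.ae_ae_comm hmeas).1 hline).and
    ((volume : Measure ℝ).ae_ne 0)).exists
  rw [ae_iff] at ht ⊢
  have himage : {x | ¬f x ≠ 0}
      = AffineMap.homothety w t '' {x | ¬f (AffineMap.homothety w t x) ≠ 0} := by
    ext y
    constructor
    · intro hy
      have hinv : AffineMap.homothety w t (AffineMap.homothety w t⁻¹ y) = y := by
        simp [AffineMap.homothety_apply, smul_smul, ht0]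
      exact ⟨AffineMap.homothety w t⁻¹ y, by simpa [hinv] using hy, hinv⟩
    · rintro ⟨x, hx, rfl⟩
      exact hx
  rw [himage, Measure.addHaar_image_homothety, ht, mul_zero]

/-- The matrix of the linear map `Γ ↦ We * diagonal Γ * Wo`, with the hidden units indexed
by pairs. -/
def rescalingMatrix {d : ℕ} (Wo : Matrix (Fin (d * d)) (Fin d) ℝ)
    (We : Matrix (Fin d) (Fin (d * d)) ℝ) : Matrix (Fin d × Fin d) (Fin d × Fin d) ℝ :=
  of fun p q => We p.1 (finProdFinEquiv q) * Wo (finProdFinEquiv q) p.2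

theorem exists_mul_diagonal_mul_eq {d : ℕ} {Wo : Matrix (Fin (d * d)) (Fin d) ℝ}
    {We : Matrix (Fin d) (Fin (d * d)) ℝ} (h : (rescalingMatrix Wo We).det ≠ 0)
    (A : Matrix (Fin d) (Fin d) ℝ) :
    ∃ Γ : Fin (d * d) → ℝ, We * diagonal Γ * Wo = A := by
  obtain ⟨γ, hγ⟩ := (mulVec_surjective_iff_isUnit.2
    ((isUnit_iff_isUnit_det _).2 (isUnit_iff_ne_zero.2 h))) fun p => A p.1 p.2
  refine ⟨γ ∘ finProdFinEquiv.symm, ?_⟩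
  ext i j
  rw [← congrFun hγ (i, j), mul_apply, ← finProdFinEquiv.sum_comp]
  simp only [mulVec, dotProduct, rescalingMatrix, mul_diagonal, of_apply, Function.comp_apply,
    Equiv.symm_apply_apply]
  exact Finset.sum_congr rfl fun _ _ => by ring

/-- On a compact set, large hidden biases make the hidden ReLUs inactive. -/
theorem exists_fBlock_eq {d : ℕ} {Wo : Matrix (Fin (d * d)) (Fin d) ℝ}
    {We : Matrix (Fin d) (Fin (d * d)) ℝ} (h : (rescalingMatrix Wo We).det ≠ 0)
    {K : Set (Fin d → ℝ)} (hK : IsCompact K) (A : Matrix (Fin d) (Fin d) ℝ) (b : Fin d → ℝ) :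
    ∃ Γo βo Γe βe, ∀ y ∈ K, fBlock Γo βo Γe βe Wo We y = A *ᵥ y + b := by
  obtain ⟨Γ, hΓ⟩ := exists_mul_diagonal_mul_eq h A
  obtain ⟨C, hC⟩ := hK.exists_bound_of_continuousOn
    (f := fun y => diagonal Γ *ᵥ (Wo *ᵥ y)) (by fun_prop)
  refine ⟨Γ, fun _ => C, 1, b - We *ᵥ fun _ => C, fun y hy => ?_⟩
  have hrelu : reluV (diagonal Γ *ᵥ (Wo *ᵥ y) + fun _ => C)
      = diagonal Γ *ᵥ (Wo *ᵥ y) + fun _ => C := by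
    funext i
    have hi := (abs_le.1 ((norm_le_pi_norm _ i).trans (hC y hy))).1
    exact max_eq_left (by simpa using neg_le_iff_add_nonneg.1 hi)
  rw [fBlock, hrelu, mulVec_add, ← hΓ]
  simp only [Pi.one_def, diagonal_one, one_mulVec, mulVec_mulVec, Matrix.mul_assoc]
  abel

theorem continuous_reluV {n : ℕ} : Continuous (reluV (n := n)) := by
  unfold reluV relu
  fun_prop

theorem continuous_gLayer {d : ℕ} (Γ : Fin d → ℝ) (V : Matrix (Fin d) (Fin d) ℝ)
    (β : Fin d → ℝ) : Continuous (gLayer Γ V β) := by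
  unfold gLayer
  fun_prop

theorem continuous_chain {α : Type*} [TopologicalSpace α] {step : ℕ → α → α}
    (h : ∀ k, Continuous (step k)) : ∀ k, Continuous (chain step k)
  | 0 => continuous_id
  | k + 1 => (h k).comp (continuous_chain h k)

theorem chain_congr_apply {α : Type*} {s t : ℕ → α → α} {x : α} :
    ∀ {n : ℕ}, (∀ k < n, s k (chain t k x) = t k (chain t k x)) → chain s n x = chain t n x
  | 0, _ => rfl
  | n + 1, h => by
    change s n (chain s n x) = t n (chain t n x)
    rw [chain_congr_apply fun k hk => h k (by omega), h n (by omega)]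

theorem isCompact_setOf_eNorm_le (d : ℕ) (r : ℝ) : IsCompact {x : Fin d → ℝ | eNorm x ≤ r} := by
  refine Metric.isCompact_of_isClosed_isBounded
    (isClosed_le (by unfold eNorm; fun_prop) continuous_const) ?_
  refine (Metric.isBounded_closedBall (x := 0) (r := |r|)).subset fun x hx => ?_
  rw [mem_closedBall_zero_iff, pi_norm_le_iff_of_nonneg (abs_nonneg r)]
  intro i
  refine le_trans ?_ ((show eNorm x ≤ r from hx).trans (le_abs_self r))
  exact Real.abs_le_sqrt (Finset.single_le_sum (f := fun i => x i ^ 2)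
    (fun _ _ => sq_nonneg _) (Finset.mem_univ i))

theorem ae_det_rescalingMatrix_ne_zero (d l : ℕ) (i : Fin l) :
    ∀ᵐ W : (Fin l → Fin (d * d) → Fin d → ℝ) × (Fin l → Fin d → Fin (d * d) → ℝ) ∂volume,
      (rescalingMatrix (of (W.1 i)) (of (W.2 i))).det ≠ 0 := by
  have hpi (a b c : ℕ) : (volume : Measure (Fin a → Fin b → Fin c → ℝ)).IsAddHaarMeasure := by
    have : (volume : Measure (Fin b → Fin c → ℝ)).IsAddHaarMeasure :=
      Measure.pi.isAddHaarMeasure _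
    exact Measure.pi.isAddHaarMeasure _
  have : (volume : Measure ((Fin l → Fin (d * d) → Fin d → ℝ) ×
      (Fin l → Fin d → Fin (d * d) → ℝ))).IsAddHaarMeasure :=
    Measure.prod.instIsAddHaarMeasure _ _
  refine AnalyticOnNhd.ae_ne_zero
    (w := (fun _ k j => if j = (finProdFinEquiv.symm k).2 then 1 else 0,
      fun _ j k => if j = (finProdFinEquiv.symm k).1 then 1 else 0)) ?_ ?_
  · simp only [det_apply, rescalingMatrix, of_apply]
    exact contDiff_omega_iff_analyticOnNhd.1 (by fun_prop)
  · convert one_ne_zero (α := ℝ)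
    rw [← det_one (n := Fin d × Fin d)]
    congr 1
    ext p q
    simp only [rescalingMatrix, of_apply, Equiv.symm_apply_apply, one_apply, Prod.ext_iff]
    split_ifs <;> simp_all

/-- For Lebesgue-almost every choice of the frozen weight matrices
`W_1, …, W_{2l}` (of shape `d²×d` for odd indices and `d×d²` for even indices), every target
ReLU network of depth `l` and width `d` with diagonal normalization matrices `Γ*_i`, weight
matrices `V_i` of Frobenius norm at most `1`, and biases `β*_i`, can be exactly realized on
the unit ball by tuning only the normalization parameters `Γ_i, β_i` of the random network. -/
theorem wide_reconstruction_by_normalization_layers (d l : ℕ) (hd : 1 ≤ d) (hl : 1 ≤ l) :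
    ∀ᵐ W : (Fin l → Fin (d * d) → Fin d → ℝ) × (Fin l → Fin d → Fin (d * d) → ℝ) ∂volume,
      ∀ (V : Fin l → Matrix (Fin d) (Fin d) ℝ) (Γstar βstar : Fin l → Fin d → ℝ),
        (∀ i, frob (V i) ≤ 1) →
        ∃ (Γo βo : Fin l → Fin (d * d) → ℝ) (Γe βe : Fin l → Fin d → ℝ),
          ∀ x : Fin d → ℝ, eNorm x ≤ 1 →
            fNet d l (ext Γo) (ext βo) (ext Γe) (ext βe)
                (ext fun i => of (W.1 i)) (ext fun i => of (W.2 i)) x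
              = gNet d l (ext Γstar) (ext V) (ext βstar) x := by
  filter_upwards [ae_all_iff.2 (ae_det_rescalingMatrix_ne_zero d l)] with W hW V Γstar βstar _
  set step : ℕ → (Fin d → ℝ) → Fin d → ℝ :=
    fun k y => reluV (gLayer (ext Γstar k) (ext V k) (ext βstar k) y)
  have hcompact (k : ℕ) : IsCompact (chain step k '' {x : Fin d → ℝ | eNorm x ≤ 1}) :=
    (isCompact_setOf_eNorm_le d 1).image
      (continuous_chain (fun k => continuous_reluV.comp (continuous_gLayer _ _ _)) k)
  choose Γo βo Γe βe hblock using fun i : Fin l =>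
    exists_fBlock_eq (hW i) (hcompact i) (diagonal (Γstar i) * V i) (βstar i)
  refine ⟨Γo, βo, Γe, βe, fun x hx => ?_⟩
  have hlayer (k : ℕ) (hk : k < l) :
      fBlock (ext Γo k) (ext βo k) (ext Γe k) (ext βe k) (ext (fun i => of (W.1 i)) k)
        (ext (fun i => of (W.2 i)) k) (chain step k x)
      = gLayer (ext Γstar k) (ext V k) (ext βstar k) (chain step k x) := by
    simp only [_root_.ext, hk, dif_pos]
    rw [gLayer, mulVec_mulVec]
    exact hblock ⟨k, hk⟩ _ ⟨x, hx, rfl⟩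
  rw [fNet, gNet, chain_congr_apply (t := step) fun k hk => ?_]
  · exact hlayer (l - 1) (by omega)
  · exact congrArg reluV (hlayer k (by omega))
end
end

section
/- Fix d ≥ 1, real numbers s ≠ 0 and s' ≠ 0, and vectors μ ∈ ℝ^{d²}, μ' ∈ ℝ^{d}. For Lebesgue-almost every pair (W, V) with W ∈ ℝ^{d²×d} and V ∈ ℝ^{d×d²}, the following holds: for every diagonal matrix Γ* ∈ ℝ^{d×d}, every V* ∈ ℝ^{d×d} and every β* ∈ ℝ^{d}, there exist diagonal matrices Γ ∈ ℝ^{d²×d²}, Γ' ∈ ℝ^{d×d} and vectors β ∈ ℝ^{d²}, β' ∈ ℝ^{d} such that for every x ∈ ℝ^{d} with ‖x‖ ≤ 1, σ( Γ' · ( V σ( Γ · (W x − μ)/s + β ) − μ' )/s' + β' ) = σ( Γ* V* x + β* ). That is, a two-layer random ReLU network of width d² with tunable Batch-Normalization scale and shift parameters exactly realizes any one-layer ReLU network of width d. -/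
noncomputable section
open MeasureTheory Matrix

/-- The matrix of the linear map `Γ ↦ V * diagonal Γ * W`, with the rows enumerated by pairs of
output and input coordinates. -/
def scaleMatrix {R : Type*} [CommRing R] {d : ℕ} (W : Fin (d * d) → Fin d → R)
    (V : Fin d → Fin (d * d) → R) : Matrix (Fin (d * d)) (Fin (d * d)) R :=
  of fun r k => V (finProdFinEquiv.symm r).1 k * W k (finProdFinEquiv.symm r).2

/-- Weights at which `scaleMatrix` is the identity. -/
def unitWeights (d : ℕ) : (Fin (d * d) → Fin d → ℝ) × (Fin d → Fin (d * d) → ℝ) :=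
  (fun k j => if (finProdFinEquiv.symm k).2 = j then 1 else 0,
    fun i k => if (finProdFinEquiv.symm k).1 = i then 1 else 0)

lemma scaleMatrix_unitWeights (d : ℕ) :
    scaleMatrix (unitWeights d).1 (unitWeights d).2 = 1 := by
  ext r k
  simp only [scaleMatrix, unitWeights, of_apply, one_apply, mul_ite, mul_one, mul_zero,
    ← ite_and]
  congr 1
  rw [← finProdFinEquiv.symm.injective.eq_iff (a := r), Prod.ext_iff, eq_iff_iff]
  exact ⟨fun h => ⟨h.2.symm, h.1.symm⟩, fun h => ⟨h.2.symm, h.1.symm⟩⟩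

lemma scaleMatrix_smul {d : ℕ} (t : ℝ) (W : Fin (d * d) → Fin d → ℝ)
    (V : Fin d → Fin (d * d) → ℝ) :
    scaleMatrix (t • W) (t • V) = (t * t) • scaleMatrix W V := by
  ext r k
  simp only [scaleMatrix, of_apply, Matrix.smul_apply, Pi.smul_apply, smul_eq_mul]
  ring

/-- Along any line through `unitWeights`, `scaleMatrix` is singular at finitely many points. -/
lemma finite_det_scaleMatrix_unitWeights_add_smul_eq_zero {d : ℕ}
    (y : (Fin (d * d) → Fin d → ℝ) × (Fin d → Fin (d * d) → ℝ)) :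
    {u : ℝ | (scaleMatrix (unitWeights d + u • y).1 (unitWeights d + u • y).2).det = 0}.Finite := by
  let p : Polynomial ℝ := (scaleMatrix
    (fun k j => .C ((unitWeights d).1 k j) + .C (y.1 k j) * .X)
    (fun i k => .C ((unitWeights d).2 i k) + .C (y.2 i k) * .X)).det
  have hp (u : ℝ) : p.eval u =
      (scaleMatrix (unitWeights d + u • y).1 (unitWeights d + u • y).2).det := by
    rw [← Polynomial.coe_evalRingHom, RingHom.map_det]
    congr 1
    ext r k
    simp [scaleMatrix, mul_comm u]
  have hp0 : p ≠ 0 := by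
    intro h
    have h0 := hp 0
    simp [h, scaleMatrix_unitWeights] at h0
  refine (p.rootSet_finite ℝ).subset fun u hu => ?_
  rw [Polynomial.mem_rootSet]
  exact ⟨hp0, by simpa [Polynomial.aeval_def, hp] using hu⟩

lemma ae_isUnit_det_scaleMatrix (d : ℕ) :
    ∀ᵐ WV : (Fin (d * d) → Fin d → ℝ) × (Fin d → Fin (d * d) → ℝ) ∂volume,
      IsUnit (scaleMatrix WV.1 WV.2).det := by
  let S : Set ((Fin (d * d) → Fin d → ℝ) × (Fin d → Fin (d * d) → ℝ)) :=
    {WV | (scaleMatrix WV.1 WV.2).det ≠ 0}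
  have hS : MeasurableSet S := by
    refine (isOpen_ne_fun (Continuous.matrix_det ?_) continuous_const).measurableSet
    refine continuous_matrix fun r k => ?_
    simp only [scaleMatrix, of_apply]
    fun_prop
  have key : ∀ᵐ WV ∂volume, WV ∈ S := by
    have hpi (m n : ℕ) : (volume : Measure (Fin m → Fin n → ℝ)).IsAddHaarMeasure :=
      Measure.pi.isAddHaarMeasure _
    have : (volume : Measure ((Fin (d * d) → Fin d → ℝ) ×
      (Fin d → Fin (d * d) → ℝ))).IsAddHaarMeasure := Measure.prod.instIsAddHaarMeasure _ _
    refine ae_mem_of_ae_add_linearMap_mem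
      (LinearMap.toSpanSingleton ℝ _ (unitWeights d)) volume volume hS fun y => ?_
    have hfin := ((finite_det_scaleMatrix_unitWeights_add_smul_eq_zero y).image (·⁻¹)).insert 0
    filter_upwards [hfin.countable.ae_notMem volume] with t ht h0
    refine ht ?_
    by_cases ht0 : t = 0
    · exact Or.inl ht0
    refine Or.inr ⟨t⁻¹, ?_, inv_inv t⟩
    have hy : y + LinearMap.toSpanSingleton ℝ _ (unitWeights d) t
        = t • (unitWeights d + t⁻¹ • y) := by
      rw [LinearMap.toSpanSingleton_apply, smul_add, smul_inv_smul₀ ht0, add_comm]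
    rw [hy, Prod.smul_fst, Prod.smul_snd, scaleMatrix_smul, det_smul] at h0
    exact (mul_eq_zero.mp h0).resolve_left (pow_ne_zero _ (mul_ne_zero ht0 ht0))
  filter_upwards [key] with WV h using isUnit_iff_ne_zero.mpr h

/-- If `scaleMatrix W V` is invertible, every square matrix has the form `V * diagonal Γ * W`. -/
lemma exists_sum_mul_mul_eq {d : ℕ} {W : Fin (d * d) → Fin d → ℝ}
    {V : Fin d → Fin (d * d) → ℝ} (h : IsUnit (scaleMatrix W V).det)
    (M : Matrix (Fin d) (Fin d) ℝ) :
    ∃ Γ : Fin (d * d) → ℝ, ∀ i j, ∑ k, V i k * Γ k * W k j = M i j := by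
  refine ⟨(scaleMatrix W V)⁻¹ *ᵥ
    fun r => M (finProdFinEquiv.symm r).1 (finProdFinEquiv.symm r).2, fun i j => ?_⟩
  set Γ := (scaleMatrix W V)⁻¹ *ᵥ
    fun r => M (finProdFinEquiv.symm r).1 (finProdFinEquiv.symm r).2 with hΓ
  have hA : (scaleMatrix W V) *ᵥ Γ =
      fun r => M (finProdFinEquiv.symm r).1 (finProdFinEquiv.symm r).2 := by
    rw [hΓ, mulVec_mulVec, mul_nonsing_inv _ h, one_mulVec]
  have hij := congrFun hA (finProdFinEquiv (i, j))
  simp only [Equiv.symm_apply_apply] at hij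
  rw [← hij]
  simp only [mulVec, dotProduct, scaleMatrix, of_apply, Equiv.symm_apply_apply]
  exact Finset.sum_congr rfl fun k _ => by ring

lemma abs_le_one_of_eNorm_le_one {n : ℕ} {x : Fin n → ℝ} (hx : eNorm x ≤ 1) (j : Fin n) :
    |x j| ≤ 1 := by
  rw [eNorm, Real.sqrt_le_one] at hx
  rw [← sq_le_one_iff_abs_le_one]
  exact (Finset.single_le_sum (f := fun i => x i ^ 2) (fun i _ => sq_nonneg _)
    (Finset.mem_univ j)).trans hx

/-- A bound, on the unit ball, for the scaled affine form `c * (w ⬝ᵥ x - m)`. -/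
lemma nonneg_scaled_affine_add {n : ℕ} (c m : ℝ) (w : Fin n → ℝ) {x : Fin n → ℝ}
    (hx : eNorm x ≤ 1) : 0 ≤ c * (∑ j, w j * x j - m) + |c| * (∑ j, |w j| + |m|) := by
  have h1 : |∑ j, w j * x j| ≤ ∑ j, |w j| := by
    refine (Finset.abs_sum_le_sum_abs _ _).trans (Finset.sum_le_sum fun j _ => ?_)
    rw [abs_mul]
    exact mul_le_of_le_one_right (abs_nonneg _) (abs_le_one_of_eNorm_le_one hx j)
  have h2 : |c * (∑ j, w j * x j - m)| ≤ |c| * (∑ j, |w j| + |m|) := by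
    rw [abs_mul]
    gcongr
    exact (abs_sub _ _).trans (by gcongr)
  linarith [neg_abs_le (c * (∑ j, w j * x j - m))]

/-- Fix `d ≥ 1`, nonzero batch variances `s, s'` and batch means `μ, μ'`.
For Lebesgue-almost every pair `(W, V)` of frozen weights, every one-layer ReLU network
`σ(Γ* V* x + β*)` of width `d` is exactly realized on the unit ball by the two-layer
random Batch-Norm network `σ( Γ'((V σ(Γ(Wx − μ)/s + β)) − μ')/s' + β' )` for a suitable
choice of the diagonal scale matrices `Γ, Γ'` and shifts `β, β'`. -/
theorem two_layer_BN_realizes_one_layer (d : ℕ) (hd : 1 ≤ d) (s s' : ℝ)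
    (hs : s ≠ 0) (hs' : s' ≠ 0) (μ : Fin (d * d) → ℝ) (μ' : Fin d → ℝ) :
    ∀ᵐ WV : (Fin (d * d) → Fin d → ℝ) × (Fin d → Fin (d * d) → ℝ) ∂volume,
      ∀ (Γstar : Fin d → ℝ) (Vstar : Matrix (Fin d) (Fin d) ℝ) (βstar : Fin d → ℝ),
        ∃ (Γ : Fin (d * d) → ℝ) (Γ' : Fin d → ℝ) (β : Fin (d * d) → ℝ) (β' : Fin d → ℝ),
          ∀ x : Fin d → ℝ, eNorm x ≤ 1 →
            reluV (diagonal Γ' *ᵥ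
                ((1 / s') • (of WV.2 *ᵥ
                    reluV (diagonal Γ *ᵥ ((1 / s) • (of WV.1 *ᵥ x - μ)) + β) - μ')) + β')
              = reluV (diagonal Γstar *ᵥ (Vstar *ᵥ x) + βstar) := by
  filter_upwards [ae_isUnit_det_scaleMatrix d] with WV hWV Γstar Vstar βstar
  obtain ⟨W, V⟩ := WV
  obtain ⟨Γ, hΓ⟩ := exists_sum_mul_mul_eq hWV ((s * s') • (diagonal Γstar * Vstar))
  let β : Fin (d * d) → ℝ := fun k => |Γ k * (1 / s)| * (∑ j, |W k j| + |μ k|)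
  refine ⟨Γ, fun _ => 1, β, fun i => βstar i -
    (1 / s') * (∑ k, V i k * (β k - Γ k * (1 / s) * μ k) - μ' i), fun x hx => ?_⟩
  have hinner : reluV (diagonal Γ *ᵥ ((1 / s) • (of W *ᵥ x - μ)) + β) =
      fun k => Γ k * (1 / s) * (∑ j, W k j * x j - μ k) + β k := by
    ext k
    have hk := nonneg_scaled_affine_add (Γ k * (1 / s)) (μ k) (W k) hx
    simp only [reluV, relu, Pi.add_apply, mulVec_diagonal, Pi.smul_apply, Pi.sub_apply,
      smul_eq_mul]
    simp only [mulVec, dotProduct, of_apply, ← mul_assoc]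
    exact max_eq_left hk
  have hsum (i : Fin d) : ∑ k, V i k * Γ k * ∑ j, W k j * x j =
      s * s' * (Γstar i * ∑ j, Vstar i j * x j) := by
    simp_rw [Finset.mul_sum]
    rw [Finset.sum_comm]
    refine Finset.sum_congr rfl fun j _ => ?_
    simp_rw [← mul_assoc]
    rw [← Finset.sum_mul, hΓ i j]
    simp [diagonal_mul, mul_assoc]
  rw [hinner]
  congr 1
  ext i
  simp only [Pi.add_apply, mulVec_diagonal, Pi.smul_apply, Pi.sub_apply, smul_eq_mul,
    one_mul]
  simp only [mulVec, dotProduct, of_apply]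
  have hsplit : ∑ k, V i k * (Γ k * (1 / s) * (∑ j, W k j * x j - μ k) + β k) =
      (1 / s) * ∑ k, V i k * Γ k * ∑ j, W k j * x j +
        ∑ k, V i k * (β k - Γ k * (1 / s) * μ k) := by
    rw [Finset.mul_sum, ← Finset.sum_add_distrib]
    exact Finset.sum_congr rfl fun k _ => by ring
  rw [hsplit, hsum]
  field_simp
  ring
end
end

section
/- Fix integers d ≥ 1 and 1 ≤ r < d. For Lebesgue-almost every tuple (W_1, W_2, W_3, W_4) with W_1 ∈ ℝ^{dr×d}, W_2 ∈ ℝ^{r×dr}, W_3 ∈ ℝ^{dr×r}, W_4 ∈ ℝ^{d×dr}, the following holds: for every matrix V* ∈ ℝ^{d×d} of rank at most r and every β* ∈ ℝ^{d}, there exist diagonal matrices Γ_1 ∈ ℝ^{dr×dr}, Γ_2 ∈ ℝ^{r×r}, Γ_3 ∈ ℝ^{dr×dr}, Γ_4 ∈ ℝ^{d×d} and vectors β_1 ∈ ℝ^{dr}, β_2 ∈ ℝ^{r}, β_3 ∈ ℝ^{dr}, β_4 ∈ ℝ^{d} such that σ( Γ_4 W_4 σ( Γ_3 W_3 σ( Γ_2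 W_2 σ( Γ_1 W_1 x + β_1 ) + β_2 ) + β_3 ) + β_4 ) = σ( V* x + β* ) for every x ∈ ℝ^{d} with ‖x‖ ≤ 1. That is, a four-layer random ReLU network of width dr with tunable normalization parameters exactly realizes any one-layer ReLU network of width d whose weight matrix has rank at most r. -/
noncomputable section
open MeasureTheory Matrix

/-- A determinant whose entries are products of two linear forms vanishes almost nowhere, as soon as
the corresponding matrix is the identity at one point. -/
theorem ae_det_mul_linearForms_ne_zero {E n : Type*} [NormedAddCommGroup E] [NormedSpace ℝ E]
    [FiniteDimensional ℝ E] [MeasurableSpace E] [BorelSpace E] (μ : Measure E)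
    [μ.IsAddHaarMeasure] [Fintype n] [DecidableEq n] (A B : n → n → E →ₗ[ℝ] ℝ) (v : E)
    (hv : (of fun i j => A i j v * B i j v) = (1 : Matrix n n ℝ)) :
    ∀ᵐ e ∂μ, (of fun i j => A i j e * B i j e : Matrix n n ℝ).det ≠ 0 := by
  have hcont : Continuous fun e => (of fun i j => A i j e * B i j e : Matrix n n ℝ).det := by
    refine Continuous.matrix_det (continuous_matrix fun i j => ?_)
    exact (A i j).continuous_of_finiteDimensional.mul (B i j).continuous_of_finiteDimensional
  refine ae_mem_of_ae_add_linearMap_mem (LinearMap.toSpanSingleton ℝ E v) volume μ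
    (s := {e | (of fun i j => A i j e * B i j e : Matrix n n ℝ).det ≠ 0})
    (hcont.measurable (measurableSet_singleton 0)).compl fun y => ?_
  let Q : Matrix n n (Polynomial ℝ) := of fun i j =>
    (Polynomial.C (A i j v) + Polynomial.X * Polynomial.C (A i j y)) *
      (Polynomial.C (B i j v) + Polynomial.X * Polynomial.C (B i j y))
  have hQ (s : ℝ) : Q.det.eval s =
      (of fun i j => A i j (v + s • y) * B i j (v + s • y) : Matrix n n ℝ).det := by
    rw [← Polynomial.coe_evalRingHom, RingHom.map_det]
    congr 1
    ext i j
    simp [Q, mul_comm s]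
  have hQ0 : Q.det ≠ 0 := by
    intro h
    have := hQ 0
    simp [h, hv] at this
  have hfin : ({0} ∪ Inv.inv ⁻¹' (Q.det.rootSet ℝ) : Set ℝ).Finite :=
    (Set.finite_singleton 0).union
      (Set.Finite.preimage inv_injective.injOn (Polynomial.rootSet_finite _ _))
  filter_upwards [hfin.countable.ae_notMem volume] with t ht
  simp only [Set.mem_union, Set.mem_singleton_iff, Set.mem_preimage, not_or,
    Polynomial.mem_rootSet, not_and] at ht
  obtain ⟨ht0, hroot⟩ := ht
  have hroot := hroot hQ0
  rw [Polynomial.coe_aeval_eq_eval, hQ] at hroot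
  have hscale : (of fun i j => A i j (y + t • v) * B i j (y + t • v) : Matrix n n ℝ) =
      (t ^ 2) • (of fun i j => A i j (v + t⁻¹ • y) * B i j (v + t⁻¹ • y) : Matrix n n ℝ) := by
    ext i j
    simp only [of_apply, Matrix.smul_apply, map_add, map_smul, smul_eq_mul]
    field_simp
    ring
  simp only [LinearMap.toSpanSingleton_apply]
  rw [hscale, det_smul]
  exact mul_ne_zero (pow_ne_zero _ (pow_ne_zero _ ht0)) hroot

theorem exists_mul_diagonal_mul_eq_s2 {k m n : Type*} [Fintype k] [DecidableEq k]
    (e : k ≃ m × n) (U : Matrix m k ℝ) (V : Matrix k n ℝ)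
    (h : (of fun a l => U (e a).1 l * V l (e a).2 : Matrix k k ℝ).det ≠ 0) (B : Matrix m n ℝ) :
    ∃ γ : k → ℝ, U * (diagonal γ * V) = B := by
  obtain ⟨γ, hγ⟩ := (mulVec_surjective_iff_isUnit.2
    ((isUnit_iff_isUnit_det _).2 h.isUnit)) fun a => B (e a).1 (e a).2
  refine ⟨γ, ?_⟩
  ext i j
  have := congrFun hγ (e.symm (i, j))
  simp only [mulVec, dotProduct, of_apply, Equiv.apply_symm_apply] at this
  rw [← this, mul_apply]
  refine Finset.sum_congr rfl fun l _ => ?_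
  rw [diagonal_mul]
  ring

/-- If matrix pairs `(U, V)` depend linearly on a point of a finite-dimensional space and can be
prescribed arbitrarily, then for almost every point every matrix factors as `U * diagonal γ * V`. -/
theorem ae_exists_mul_diagonal_mul_eq {E k m n : Type*} [NormedAddCommGroup E] [NormedSpace ℝ E]
    [FiniteDimensional ℝ E] [MeasurableSpace E] [BorelSpace E] (μ : Measure E)
    [μ.IsAddHaarMeasure] [Fintype k] [DecidableEq k] (e : k ≃ m × n)
    (U : E →ₗ[ℝ] (m → k → ℝ)) (V : E →ₗ[ℝ] (k → n → ℝ))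
    (hUV : ∀ u v, ∃ w, U w = u ∧ V w = v) :
    ∀ᵐ w ∂μ, ∀ B : Matrix m n ℝ, ∃ γ : k → ℝ, of (U w) * (diagonal γ * of (V w)) = B := by
  classical
  obtain ⟨w₀, hU, hV⟩ := hUV (fun i l => if (e l).1 = i then 1 else 0)
    (fun l j => if (e l).2 = j then 1 else 0)
  have := ae_det_mul_linearForms_ne_zero μ
    (fun a l => LinearMap.proj l ∘ₗ LinearMap.proj (e a).1 ∘ₗ U)
    (fun a l => LinearMap.proj (e a).2 ∘ₗ LinearMap.proj l ∘ₗ V) w₀ (by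
      ext a l
      simp only [of_apply, LinearMap.comp_apply, LinearMap.proj_apply, hU, hV, one_apply]
      simp only [← e.injective.eq_iff (a := a), Prod.ext_iff]
      grind)
  filter_upwards [this] with w hw B
  exact exists_mul_diagonal_mul_eq_s2 e (of (U w)) (of (V w)) hw B

theorem Matrix.exists_eq_mul_of_rank_le {K m n : Type*} [Field K] [Fintype m]
    [Fintype n] {r : ℕ} (M : Matrix m n K) (h : M.rank ≤ r) :
    ∃ (A : Matrix m (Fin r) K) (B : Matrix (Fin r) n K), M = A * B := by
  classical
  obtain ⟨f, hf⟩ := (finrank_le_iff_exists_linearMap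
    (R := K) (M := LinearMap.range M.mulVecLin) (M' := Fin r → K)).1 (by simpa [Matrix.rank] using h)
  obtain ⟨g, hg⟩ := f.exists_leftInverse_of_injective (LinearMap.ker_eq_bot.2 hf)
  refine ⟨LinearMap.toMatrix' ((LinearMap.range M.mulVecLin).subtype ∘ₗ g),
    LinearMap.toMatrix' (f ∘ₗ M.mulVecLin.rangeRestrict), ?_⟩
  rw [← LinearMap.toMatrix'_comp, LinearMap.comp_assoc, ← LinearMap.comp_assoc _ f g, hg]
  rw [LinearMap.id_comp, LinearMap.rangeRestrict, LinearMap.subtype_comp_codRestrict]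
  exact (LinearMap.toMatrix'_toLin' M).symm

theorem abs_le_eNorm {n : ℕ} (x : Fin n → ℝ) (i : Fin n) : |x i| ≤ eNorm x :=
  Real.abs_le_sqrt (Finset.single_le_sum (f := fun j => x j ^ 2) (fun _ _ => sq_nonneg _)
    (Finset.mem_univ i))

/-- On the unit ball a ReLU layer with a sufficiently large bias is affine. -/
theorem exists_bias_reluV_eq {m n : ℕ} (M : Matrix (Fin m) (Fin n) ℝ) :
    ∃ c : Fin m → ℝ, ∀ x, eNorm x ≤ 1 → reluV (M *ᵥ x + c) = M *ᵥ x + c := by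
  refine ⟨fun i => ∑ j, |M i j|, fun x hx => funext fun i => max_eq_left ?_⟩
  have : |∑ j, M i j * x j| ≤ ∑ j, |M i j| := by
    refine (Finset.abs_sum_le_sum_abs _ _).trans (Finset.sum_le_sum fun j _ => ?_)
    rw [abs_mul]
    exact mul_le_of_le_one_right (abs_nonneg _) ((abs_le_eNorm x j).trans hx)
  simp only [Pi.add_apply, mulVec, dotProduct]
  linarith [neg_le_of_abs_le this]

/-- The space of weight tuples `(W₁, W₂, W₃, W₄)`. -/
abbrev WeightTuple (d r : ℕ) : Type :=
  (Fin (d * r) → Fin d → ℝ) × (Fin r → Fin (d * r) → ℝ) ×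
    (Fin (d * r) → Fin r → ℝ) × (Fin d → Fin (d * r) → ℝ)

set_option synthInstance.maxSize 1000 in
theorem isAddHaarMeasure_volume_weightTuple (d r : ℕ) :
    (volume : Measure (WeightTuple d r)).IsAddHaarMeasure := by
  rw [Measure.volume_eq_prod, Measure.volume_eq_prod, Measure.volume_eq_prod]
  infer_instance

/-- Fix `1 ≤ r < d`. For Lebesgue-almost every tuple of frozen weights
`(W₁, W₂, W₃, W₄)` with `W₁ ∈ ℝ^{dr×d}`, `W₂ ∈ ℝ^{r×dr}`, `W₃ ∈ ℝ^{dr×r}`, `W₄ ∈ ℝ^{d×dr}`,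
every one-layer ReLU network `σ(V* x + β*)` with `rank V* ≤ r` is exactly realized on the
unit ball by the four-layer random network with tunable diagonal normalization parameters. -/
theorem four_layer_realizes_low_rank_layer (d r : ℕ) (hr : 1 ≤ r) (hrd : r < d) :
    ∀ᵐ W : (Fin (d * r) → Fin d → ℝ) × (Fin r → Fin (d * r) → ℝ) ×
           (Fin (d * r) → Fin r → ℝ) × (Fin d → Fin (d * r) → ℝ) ∂volume,
      ∀ (Vstar : Matrix (Fin d) (Fin d) ℝ) (βstar : Fin d → ℝ),
        Vstar.rank ≤ r →
        ∃ (Γ1 β1 : Fin (d * r) → ℝ) (Γ2 β2 : Fin r → ℝ) (Γ3 β3 : Fin (d * r) → ℝ)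
          (Γ4 β4 : Fin d → ℝ),
          ∀ x : Fin d → ℝ, eNorm x ≤ 1 →
            reluV (diagonal Γ4 *ᵥ (of W.2.2.2 *ᵥ
                reluV (diagonal Γ3 *ᵥ (of W.2.2.1 *ᵥ
                  reluV (diagonal Γ2 *ᵥ (of W.2.1 *ᵥ
                    reluV (diagonal Γ1 *ᵥ (of W.1 *ᵥ x) + β1)) + β2)) + β3)) + β4)
              = reluV (Vstar *ᵥ x + βstar) := by
  have := isAddHaarMeasure_volume_weightTuple d r
  have hinner := ae_exists_mul_diagonal_mul_eq (volume : Measure (WeightTuple d r))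
    (finProdFinEquiv.symm.trans (Equiv.prodComm (Fin d) (Fin r)))
    (LinearMap.fst ℝ _ _ ∘ₗ LinearMap.snd ℝ _ _)
    (LinearMap.fst ℝ _ _) fun u v => ⟨(v, u, 0, 0), rfl, rfl⟩
  have houter := ae_exists_mul_diagonal_mul_eq (volume : Measure (WeightTuple d r))
    (finProdFinEquiv (m := d) (n := r)).symm
    (LinearMap.snd ℝ _ _ ∘ₗ LinearMap.snd ℝ _ _ ∘ₗ LinearMap.snd ℝ _ _)
    (LinearMap.fst ℝ _ _ ∘ₗ LinearMap.snd ℝ _ _ ∘ₗ LinearMap.snd ℝ _ _)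
    fun u v => ⟨(0, 0, v, u), rfl, rfl⟩
  filter_upwards [hinner, houter] with W hinner houter Vstar βstar hrank
  obtain ⟨A, B, rfl⟩ := Vstar.exists_eq_mul_of_rank_le hrank
  obtain ⟨Γ1, hΓ1⟩ := hinner B
  obtain ⟨Γ3, hΓ3⟩ := houter A
  simp only [LinearMap.comp_apply, LinearMap.fst_apply, LinearMap.snd_apply] at hΓ1 hΓ3
  obtain ⟨c1, hc1⟩ := exists_bias_reluV_eq (diagonal Γ1 * of W.1)
  obtain ⟨c2, hc2⟩ := exists_bias_reluV_eq B
  obtain ⟨c3, hc3⟩ := exists_bias_reluV_eq (diagonal Γ3 * of W.2.2.1 * B)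
  refine ⟨Γ1, c1, fun _ => 1, c2 - of W.2.1 *ᵥ c1, Γ3,
    c3 - (diagonal Γ3 * of W.2.2.1) *ᵥ c2, fun _ => 1, βstar - of W.2.2.2 *ᵥ c3, fun x hx => ?_⟩
  rw [diagonal_one, diagonal_one, one_mulVec, one_mulVec, mulVec_mulVec _ (diagonal Γ1), hc1 x hx,
    mulVec_add,
    mulVec_mulVec _ (of W.2.1), hΓ1, add_assoc, add_sub_cancel, hc2 x hx, mulVec_mulVec, mulVec_add,
    mulVec_mulVec, add_assoc, add_sub_cancel, hc3 x hx, mulVec_add, mulVec_mulVec,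
    ← Matrix.mul_assoc, hΓ3, add_assoc, add_sub_cancel]
end
end

section
/- Fix integers n, m ≥ 1, a diagonal matrix D ∈ ℝ^{nm×nm} all of whose diagonal entries are nonzero, and a fixed nonzero vector w ∈ ℝ^{nm}. Then for Lebesgue-almost every pair (A, C) with A ∈ ℝ^{n×nm} and C ∈ ℝ^{m×nm}, the matrix B = (A D) ⊛ C ∈ ℝ^{nm×nm} is invertible, and every row of B^{−1} has nonzero inner product with w: ⟨(B^{−1})_{i,·}, w⟩ ≠ 0 for every i ∈ {1,…,nm}. -/
noncomputable section
open MeasureTheory Matrix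

/-- The Khatri-Rao (column-wise Kronecker) product of `A ∈ ℝ^{n×nm}` and `B ∈ ℝ^{m×nm}`:
the entry in row `i·m + j` and column `k` is `A i k * B j k`. -/
def kr {α : Type*} [Mul α] {n m : ℕ} (A : Matrix (Fin n) (Fin (n * m)) α)
    (B : Matrix (Fin m) (Fin (n * m)) α) : Matrix (Fin (n * m)) (Fin (n * m)) α :=
  of fun r k => A r.divNat k * B r.modNat k

/-- The zero set of a real analytic function which does not vanish identically is null. -/
theorem ae_ne_zero_of_analyticOnNhd {E : Type*} [NormedAddCommGroup E] [NormedSpace ℝ E]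
    [FiniteDimensional ℝ E] [MeasurableSpace E] [BorelSpace E] (μ : Measure E)
    [μ.IsAddHaarMeasure] {f : E → ℝ} (hf : AnalyticOnNhd ℝ f Set.univ) {p : E} (hp : f p ≠ 0) :
    ∀ᵐ x ∂μ, f x ≠ 0 := by
  have hfc : Continuous f := continuousOn_univ.1 hf.continuousOn
  have hline : ∀ x, ∀ᵐ t : ℝ, f (t • x + p) ≠ 0 := by
    intro x
    have hg : AnalyticOnNhd ℝ (fun t : ℝ => f (t • x + p)) Set.univ := fun t _ =>
      (hf _ (Set.mem_univ _)).fun_comp (f := fun t : ℝ => t • x + p) (by fun_prop)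
    have hcod := hg.preimage_zero_mem_codiscrete (x := 0) (by simpa using hp)
    have hle := ae_restrict_le_codiscreteWithin (μ := (volume : Measure ℝ)) MeasurableSet.univ
    rw [Measure.restrict_univ] at hle
    exact hle hcod
  have hmeas : MeasurableSet {q : E × ℝ | f (q.2 • q.1 + p) ≠ 0} :=
    (measurableSet_singleton (0 : ℝ)).compl.preimage (by fun_prop)
  have hswap : ∀ᵐ t : ℝ, ∀ᵐ x ∂μ, f (t • x + p) ≠ 0 :=
    (Measure.ae_ae_comm hmeas).1 (ae_of_all _ hline)
  obtain ⟨t, ht, ht0⟩ := (hswap.and (Measure.ae_ne volume 0)).exists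
  have hscale : ∀ᵐ y ∂μ, f (y + p) ≠ 0 := by
    have h := Measure.addHaar_preimage_smul μ ht0 {y | ¬ f (y + p) ≠ 0}
    rw [show ((t • ·) ⁻¹' {y : E | ¬ f (y + p) ≠ 0}) = {x | ¬ f (t • x + p) ≠ 0} from rfl,
      ae_iff.1 ht, eq_comm, mul_eq_zero] at h
    refine h.resolve_left ?_
    exact (ENNReal.ofReal_pos.2 (abs_pos.2 (inv_ne_zero (pow_ne_zero _ ht0)))).ne'
  have h := measure_preimage_add_right μ p {y | ¬ f y ≠ 0}
  exact ae_iff.2 (h.symm.trans (ae_iff.1 hscale))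

theorem AnalyticOnNhd.matrix_det {E ι : Type*} [NormedAddCommGroup E] [NormedSpace ℝ E]
    [Fintype ι] [DecidableEq ι] {M : E → Matrix ι ι ℝ} {s : Set E}
    (hM : ∀ i j, AnalyticOnNhd ℝ (fun x => M x i j) s) :
    AnalyticOnNhd ℝ (fun x => (M x).det) s := by
  simp only [det_apply']
  exact Finset.analyticOnNhd_fun_sum _ fun σ _ =>
    analyticOnNhd_const.mul (Finset.analyticOnNhd_fun_prod _ fun i _ => hM _ _)

theorem AnalyticOnNhd.matrix_cramer {E ι : Type*} [NormedAddCommGroup E] [NormedSpace ℝ E]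
    [Fintype ι] [DecidableEq ι] {M : E → Matrix ι ι ℝ} {s : Set E}
    (hM : ∀ i j, AnalyticOnNhd ℝ (fun x => M x i j) s) (w : ι → ℝ) (i : ι) :
    AnalyticOnNhd ℝ (fun x => cramer (M x) w i) s := by
  simp only [cramer_apply]
  refine AnalyticOnNhd.matrix_det fun j k => ?_
  by_cases hk : k = i
  · simpa [updateCol_apply, hk] using analyticOnNhd_const
  · simpa [updateCol_apply, hk] using hM j k

theorem kr_mul_diagonal_apply {n m : ℕ} (A : Matrix (Fin n) (Fin (n * m)) ℝ)
    (C : Matrix (Fin m) (Fin (n * m)) ℝ) (d : Fin (n * m) → ℝ) (r k : Fin (n * m)) :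
    kr (A * diagonal d) C r k = A r.divNat k * d k * C r.modNat k := by
  simp [kr, mul_diagonal]

/-- Every permutation matrix is of the form `(A D) ⊛ C` when `D` is diagonal and invertible. -/
theorem exists_kr_mul_diagonal_eq_permMatrix {n m : ℕ} {d : Fin (n * m) → ℝ}
    (hd : ∀ i, d i ≠ 0) (σ : Equiv.Perm (Fin (n * m))) :
    ∃ AC : (Fin n → Fin (n * m) → ℝ) × (Fin m → Fin (n * m) → ℝ),
      kr (of AC.1 * diagonal d) (of AC.2) = σ.permMatrix ℝ := by
  refine ⟨(fun a k => if a = (σ.symm k).divNat then (d k)⁻¹ else 0,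
    fun c k => if c = (σ.symm k).modNat then 1 else 0), ?_⟩
  ext r k
  have hr : σ r = k ↔ r.divNat = (σ.symm k).divNat ∧ r.modNat = (σ.symm k).modNat := by
    rw [← Equiv.eq_symm_apply, ← finProdFinEquiv.symm.injective.eq_iff, Prod.ext_iff]
    rfl
  have hσ : σ.permMatrix ℝ r k = if σ r = k then 1 else 0 := by
    simp [Equiv.Perm.permMatrix, PEquiv.toMatrix_apply, Equiv.toPEquiv_apply, eq_comm]
  rw [kr_mul_diagonal_apply, hσ]
  by_cases h1 : r.divNat = (σ.symm k).divNat <;> by_cases h2 : r.modNat = (σ.symm k).modNat <;>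
    simp [hr, h1, h2, hd k]

theorem cramer_permMatrix_ne_zero {ι : Type*} [Fintype ι] [DecidableEq ι] (σ : Equiv.Perm ι)
    {w : ι → ℝ} {j : ι} (hj : w j ≠ 0) : cramer (σ.permMatrix ℝ) w (σ j) ≠ 0 := by
  have h := congrFun (mulVec_cramer (σ.permMatrix ℝ) w) j
  rw [permMatrix_mulVec] at h
  rw [show cramer (σ.permMatrix ℝ) w (σ j) = _ from h, Pi.smul_apply, det_permutation, smul_eq_mul]
  exact mul_ne_zero (by simp) hj

/-- Fix a diagonal matrix `D ∈ ℝ^{nm×nm}` with nonzero diagonal entries and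
a nonzero vector `w ∈ ℝ^{nm}`. For Lebesgue-almost every pair `(A, C)`, the Khatri-Rao
product `B = (A D) ⊛ C` is invertible and every row of `B⁻¹` has nonzero inner product
with `w`. -/
theorem kr_inverse_rows_not_orthogonal (n m : ℕ) (hn : 1 ≤ n) (hm : 1 ≤ m)
    (D : Matrix (Fin (n * m)) (Fin (n * m)) ℝ)
    (hDoff : ∀ i j, i ≠ j → D i j = 0) (hDdiag : ∀ i, D i i ≠ 0)
    (w : Fin (n * m) → ℝ) (hw : w ≠ 0) :
    ∀ᵐ AC : (Fin n → Fin (n * m) → ℝ) × (Fin m → Fin (n * m) → ℝ) ∂volume,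
      IsUnit (kr (of AC.1 * D) (of AC.2)) ∧
      ∀ i : Fin (n * m), (kr (of AC.1 * D) (of AC.2))⁻¹ i ⬝ᵥ w ≠ 0 := by
  obtain ⟨d, rfl⟩ : ∃ d, D = diagonal d :=
    ⟨fun i => D i i, by
      ext i j
      by_cases h : i = j
      · simp [h]
      · simp [h, hDoff i j h]⟩
  have hd : ∀ i, d i ≠ 0 := by simpa using hDdiag
  have han : ∀ r k, AnalyticOnNhd ℝ
      (fun AC : (Fin n → Fin (n * m) → ℝ) × (Fin m → Fin (n * m) → ℝ) =>
        kr (of AC.1 * diagonal d) (of AC.2) r k) Set.univ := by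
    intro r k
    simp only [kr_mul_diagonal_apply, of_apply]
    have hcoord {p : ℕ} (a : Fin p) : AnalyticOnNhd ℝ
        (fun M : Fin p → Fin (n * m) → ℝ => M a k) Set.univ := fun M _ =>
      ((ContinuousLinearMap.proj (R := ℝ) (φ := fun _ : Fin (n * m) => ℝ) k).comp
        (ContinuousLinearMap.proj (φ := fun _ : Fin p => Fin (n * m) → ℝ) a)).analyticAt M
    exact (((hcoord _).comp analyticOnNhd_fst (Set.mapsTo_univ _ _)).mul analyticOnNhd_const).mul
      ((hcoord _).comp analyticOnNhd_snd (Set.mapsTo_univ _ _))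
  have (p : ℕ) : (volume : Measure (Fin p → Fin (n * m) → ℝ)).IsAddHaarMeasure :=
    Measure.pi.isAddHaarMeasure _
  have : (volume : Measure ((Fin n → Fin (n * m) → ℝ) ×
      (Fin m → Fin (n * m) → ℝ))).IsAddHaarMeasure := Measure.prod.instIsAddHaarMeasure _ _
  have hdet : ∀ᵐ AC : (Fin n → Fin (n * m) → ℝ) × (Fin m → Fin (n * m) → ℝ) ∂volume,
      (kr (of AC.1 * diagonal d) (of AC.2)).det ≠ 0 := by
    obtain ⟨p, hp⟩ := exists_kr_mul_diagonal_eq_permMatrix hd 1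
    exact ae_ne_zero_of_analyticOnNhd volume (.matrix_det han) (p := p) (by simp [hp])
  obtain ⟨j, hj⟩ := Function.ne_iff.1 hw
  have hcramer : ∀ᵐ AC : (Fin n → Fin (n * m) → ℝ) × (Fin m → Fin (n * m) → ℝ) ∂volume,
      ∀ i, cramer (kr (of AC.1 * diagonal d) (of AC.2)) w i ≠ 0 := by
    refine ae_all_iff.2 fun i => ?_
    obtain ⟨p, hp⟩ := exists_kr_mul_diagonal_eq_permMatrix hd (Equiv.swap j i)
    refine ae_ne_zero_of_analyticOnNhd volume (.matrix_cramer han w i) (p := p) ?_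
    simpa [hp] using cramer_permMatrix_ne_zero (Equiv.swap j i) hj
  filter_upwards [hdet, hcramer] with AC h1 h2
  refine ⟨(isUnit_iff_isUnit_det _).2 h1.isUnit, fun i => ?_⟩
  have h3 := h2 i
  rw [cramer_eq_adjugate_mulVec] at h3
  have h4 : (kr (of AC.1 * diagonal d) (of AC.2))⁻¹ i ⬝ᵥ w =
      Ring.inverse (kr (of AC.1 * diagonal d) (of AC.2)).det •
        ((kr (of AC.1 * diagonal d) (of AC.2)).adjugate *ᵥ w) i := by
    rw [inv_def]
    exact smul_dotProduct (Ring.inverse (det _) : ℝ) (adjugate _ i) w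
  rw [h4, smul_eq_mul, Ring.inverse_eq_inv]
  exact mul_ne_zero (inv_ne_zero h1) h3
end
end

section
/- Fix integers n, m ≥ 1. For Lebesgue-almost every pair (A, B) with A ∈ ℝ^{n×nm} and B ∈ ℝ^{m×nm}, the Khatri-Rao product A ⊛ B ∈ ℝ^{nm×nm} is invertible (has full rank nm). -/
noncomputable section
open MeasureTheory Matrix

/-- If a continuous function on a finite-dimensional real vector space is nonzero almost
everywhere along each line through a fixed point, then it is nonzero almost everywhere. -/
theorem ae_ne_zero_of_ae_line_ne_zero {E : Type*} [NormedAddCommGroup E] [NormedSpace ℝ E]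
    [FiniteDimensional ℝ E] [MeasurableSpace E] [BorelSpace E] (μ : Measure E)
    [μ.IsAddHaarMeasure] {f : E → ℝ} (hf : Continuous f) (x₀ : E)
    (h : ∀ x, ∀ᵐ t : ℝ, f (x₀ + t • x) ≠ 0) : ∀ᵐ x ∂μ, f x ≠ 0 := by
  have hopen : IsOpen {p : E × ℝ | f (x₀ + p.2 • p.1) ≠ 0} :=
    isOpen_ne_fun (by fun_prop) continuous_const
  have hswap : ∀ᵐ t : ℝ, ∀ᵐ x ∂μ, f (x₀ + t • x) ≠ 0 :=
    (Measure.ae_ae_comm (μ := μ) (ν := (volume : Measure ℝ)) hopen.measurableSet).1 (ae_of_all _ h)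
  obtain ⟨t, ht, ht₀⟩ := (hswap.and (Measure.ae_ne volume (0 : ℝ))).exists
  have hsmul := Measure.quasiMeasurePreserving_smul μ (inv_ne_zero ht₀)
  have hsub := (measurePreserving_sub_right μ x₀).quasiMeasurePreserving
  filter_upwards [(hsmul.comp hsub).ae ht] with x hx
  simpa [smul_smul, ht₀] using hx

theorem kr_map {α β : Type*} [CommRing α] [CommRing β] (φ : α →+* β) {n m : ℕ}
    (A : Matrix (Fin n) (Fin (n * m)) α) (B : Matrix (Fin m) (Fin (n * m)) α) :
    (kr A B).map φ = kr (A.map φ) (B.map φ) := by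
  ext
  simp [kr]

/-- The standard basis vectors `e_i ⊗ e_j` form a Khatri-Rao product equal to the identity. -/
theorem kr_indicator_eq_one (n m : ℕ) :
    kr (of fun (i : Fin n) (k : Fin (n * m)) ↦ if k.divNat = i then (1 : ℝ) else 0)
      (of fun (j : Fin m) (k : Fin (n * m)) ↦ if k.modNat = j then (1 : ℝ) else 0) = 1 := by
  ext r k
  have hinj : k = r ↔ k.divNat = r.divNat ∧ k.modNat = r.modNat := by
    rw [← finProdFinEquiv.symm.injective.eq_iff, Prod.ext_iff]
    rfl
  simp only [kr, of_apply, one_apply, eq_comm (a := r), hinj, ← ite_and, mul_ite, mul_one, mul_zero]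
  split_ifs <;> simp_all

/-- The determinant of a Khatri-Rao product is a polynomial function along each line. -/
theorem exists_polynomial_det_kr {n m : ℕ} (A A' : Fin n → Fin (n * m) → ℝ)
    (B B' : Fin m → Fin (n * m) → ℝ) :
    ∃ p : Polynomial ℝ, ∀ t, p.eval t = (kr (of (A + t • A')) (of (B + t • B'))).det := by
  refine ⟨(kr (of fun i k ↦ .C (A i k) + .X * .C (A' i k))
    (of fun j k ↦ .C (B j k) + .X * .C (B' j k))).det, fun t ↦ ?_⟩
  rw [← Polynomial.coe_evalRingHom, RingHom.map_det, RingHom.mapMatrix_apply, kr_map]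
  congr 2 <;> ext <;> simp only [of_apply, map_apply, Pi.add_apply, Pi.smul_apply, smul_eq_mul,
    Polynomial.coe_evalRingHom, Polynomial.eval_add, Polynomial.eval_mul, Polynomial.eval_C,
    Polynomial.eval_X]

/-- For Lebesgue-almost every pair `(A, B)` with `A ∈ ℝ^{n×nm}` and
`B ∈ ℝ^{m×nm}`, the Khatri-Rao product `A ⊛ B ∈ ℝ^{nm×nm}` is invertible. -/
theorem khatri_rao_ae_invertible (n m : ℕ) (hn : 1 ≤ n) (hm : 1 ≤ m) :
    ∀ᵐ AB : (Fin n → Fin (n * m) → ℝ) × (Fin m → Fin (n * m) → ℝ) ∂volume,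
      IsUnit (kr (of AB.1) (of AB.2)) := by
  simp_rw [isUnit_iff_isUnit_det, isUnit_iff_ne_zero]
  have hcont : Continuous fun AB : (Fin n → Fin (n * m) → ℝ) × (Fin m → Fin (n * m) → ℝ) ↦
      (kr (of AB.1) (of AB.2)).det := by
    refine Continuous.matrix_det (continuous_matrix fun r k ↦ ?_)
    simp only [kr, of_apply]
    fun_prop
  have hpi (l : ℕ) : (volume : Measure (Fin l → Fin (n * m) → ℝ)).IsAddHaarMeasure :=
    Measure.pi.isAddHaarMeasure fun _ ↦ volume
  have : (volume : Measure ((Fin n → Fin (n * m) → ℝ) ×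
      (Fin m → Fin (n * m) → ℝ))).IsAddHaarMeasure :=
    Measure.prod.instIsAddHaarMeasure volume volume
  refine ae_ne_zero_of_ae_line_ne_zero volume hcont
    (fun i k ↦ if k.divNat = i then 1 else 0, fun j k ↦ if k.modNat = j then 1 else 0)
    fun AB ↦ ?_
  obtain ⟨p, hp⟩ := exists_polynomial_det_kr
    (fun (i : Fin n) (k : Fin (n * m)) ↦ if k.divNat = i then (1 : ℝ) else 0) AB.1
    (fun (j : Fin m) (k : Fin (n * m)) ↦ if k.modNat = j then (1 : ℝ) else 0) AB.2
  have hp₀ : p ≠ 0 := by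
    rintro rfl
    have := hp 0
    rw [zero_smul, zero_smul, add_zero, add_zero, kr_indicator_eq_one] at this
    simp at this
  have hroots : (volume : Measure ℝ) {t | p.IsRoot t} = 0 :=
    (Polynomial.finite_setOfPred_isRoot hp₀).measure_zero _
  filter_upwards [measure_eq_zero_iff_ae_notMem.1 hroots] with t ht hdet
  exact ht ((hp t).trans hdet)
end
end

section
/- Fix integers n, m ≥ 1. For Lebesgue-almost every tuple (A, B, C, D) with A ∈ ℝ^{n×nm}, B ∈ ℝ^{nm×nm}, C ∈ ℝ^{m×nm} and D ∈ ℝ^{nm×nm}, both of the nm×nm matrices (A B) ⊛ (C D) and A ⊛ (C D) are invertible. -/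
noncomputable section
open MeasureTheory Matrix

open scoped ContDiff

/-- A real-analytic function on a finite-dimensional space that is
nonzero somewhere vanishes only on a null set. -/
theorem ae_ne_zero_of_contDiff_omega {E : Type*} [NormedAddCommGroup E] [NormedSpace ℝ E]
    [FiniteDimensional ℝ E] [MeasurableSpace E] [BorelSpace E] (μ : Measure E)
    [μ.IsAddHaarMeasure] {f : E → ℝ} (hf : ContDiff ℝ ω f) {x₀ : E} (hx₀ : f x₀ ≠ 0) :
    ∀ᵐ x ∂μ, f x ≠ 0 := by
  have hline (v : E) : ∀ᵐ t : ℝ, f (x₀ + t • v) ≠ 0 := by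
    have hg : ContDiff ℝ ω (fun t : ℝ => f (x₀ + t • v)) := by fun_prop
    have hg' := contDiff_omega_iff_analyticOnNhd.1 hg
    have hc := hg'.preimage_zero_mem_codiscrete (x := (0 : ℝ)) (by simpa using hx₀)
    have h := ae_restrict_le_codiscreteWithin (μ := (volume : Measure ℝ)) MeasurableSet.univ hc
    rw [Measure.restrict_univ] at h
    filter_upwards [h] with t ht using ht
  have hmeas : MeasurableSet {p : E × ℝ | f (x₀ + p.2 • p.1) ≠ 0} := by
    have : Continuous (fun p : E × ℝ => f (x₀ + p.2 • p.1)) := by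
      have := hf.continuous
      fun_prop
    exact (isOpen_ne_fun this continuous_const).measurableSet
  have hswap : ∀ᵐ t : ℝ, ∀ᵐ v ∂μ, f (x₀ + t • v) ≠ 0 :=
    (Measure.ae_ae_comm hmeas).1 (Filter.Eventually.of_forall hline)
  obtain ⟨t, ht, ht0⟩ := (hswap.and (Measure.ae_ne volume (0 : ℝ))).exists
  have hx : ∀ᵐ x ∂μ, f (x₀ + x) ≠ 0 := by
    filter_upwards [(Measure.quasiMeasurePreserving_smul μ (inv_ne_zero ht0)).ae ht] with x hx
    simpa [smul_inv_smul₀ ht0] using hx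
  have h : ∀ᵐ x ∂μ, f (x₀ + (-x₀ + x)) ≠ 0 :=
    (measurePreserving_add_left μ (-x₀)).quasiMeasurePreserving.ae hx
  simpa using h

/-- The product of two additive Haar volumes on finite-dimensional spaces is additive Haar. -/
theorem isAddHaarMeasure_volume_prod (E F : Type*) [NormedAddCommGroup E] [NormedSpace ℝ E]
    [FiniteDimensional ℝ E] [MeasureSpace E] [BorelSpace E] [NormedAddCommGroup F]
    [NormedSpace ℝ F] [FiniteDimensional ℝ F] [MeasureSpace F] [BorelSpace F]
    [(volume : Measure E).IsAddHaarMeasure] (hF : (volume : Measure F).IsAddHaarMeasure) :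
    (volume : Measure (E × F)).IsAddHaarMeasure :=
  have := FiniteDimensional.proper_real E
  have := FiniteDimensional.proper_real F
  Measure.prod.instIsAddHaarMeasure _ _

/-- The Khatri-Rao product of the row-index indicator matrices is the identity. -/
theorem kr_indicator {n m : ℕ} :
    kr (of fun (i : Fin n) (k : Fin (n * m)) => if k.divNat = i then (1 : ℝ) else 0)
      (of fun (j : Fin m) (k : Fin (n * m)) => if k.modNat = j then (1 : ℝ) else 0) = 1 := by
  ext r k
  have h : r = k ↔ k.divNat = r.divNat ∧ k.modNat = r.modNat := by
    rw [← finProdFinEquiv.symm.injective.eq_iff]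
    simp [finProdFinEquiv, eq_comm]
  simp only [kr, of_apply, one_apply, h, ite_and, mul_ite, mul_one, mul_zero]
  split_ifs <;> rfl

/-- For Lebesgue-almost every tuple `(A, B, C, D)` with `A ∈ ℝ^{n×nm}`,
`B ∈ ℝ^{nm×nm}`, `C ∈ ℝ^{m×nm}`, `D ∈ ℝ^{nm×nm}`, both Khatri-Rao products
`(A B) ⊛ (C D)` and `A ⊛ (C D)` are invertible. -/
theorem khatri_rao_products_ae_invertible (n m : ℕ) (hn : 1 ≤ n) (hm : 1 ≤ m) :
    ∀ᵐ T : (Fin n → Fin (n * m) → ℝ) × (Fin (n * m) → Fin (n * m) → ℝ) ×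
           (Fin m → Fin (n * m) → ℝ) × (Fin (n * m) → Fin (n * m) → ℝ) ∂volume,
      IsUnit (kr (of T.1 * of T.2.1) (of T.2.2.1 * of T.2.2.2)) ∧
      IsUnit (kr (of T.1) (of T.2.2.1 * of T.2.2.2)) := by
  let f (T : (Fin n → Fin (n * m) → ℝ) × (Fin (n * m) → Fin (n * m) → ℝ) ×
      (Fin m → Fin (n * m) → ℝ) × (Fin (n * m) → Fin (n * m) → ℝ)) : ℝ :=
    (kr (of T.1 * of T.2.1) (of T.2.2.1 * of T.2.2.2)).det *
      (kr (of T.1) (of T.2.2.1 * of T.2.2.2)).det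
  have hf : ContDiff ℝ ω f := by
    simp only [f, det_apply', kr, of_apply, mul_apply]
    fun_prop
  let T₀ : (Fin n → Fin (n * m) → ℝ) × (Fin (n * m) → Fin (n * m) → ℝ) ×
      (Fin m → Fin (n * m) → ℝ) × (Fin (n * m) → Fin (n * m) → ℝ) :=
    (fun i k => if k.divNat = i then 1 else 0, (1 : Matrix _ _ ℝ),
      fun j k => if k.modNat = j then 1 else 0, (1 : Matrix _ _ ℝ))
  have hone : of (1 : Matrix (Fin (n * m)) (Fin (n * m)) ℝ) = 1 := rfl
  have hT₀ : f T₀ ≠ 0 := by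
    simp [f, T₀, hone, kr_indicator]
  have hvol (k l : ℕ) : (volume : Measure (Fin k → Fin l → ℝ)).IsAddHaarMeasure :=
    Measure.pi.isAddHaarMeasure fun _ => volume
  have hvol' : (volume : Measure ((Fin n → Fin (n * m) → ℝ) × (Fin (n * m) → Fin (n * m) → ℝ) ×
      (Fin m → Fin (n * m) → ℝ) × (Fin (n * m) → Fin (n * m) → ℝ))).IsAddHaarMeasure :=
    isAddHaarMeasure_volume_prod _ _ (isAddHaarMeasure_volume_prod _ _
      (isAddHaarMeasure_volume_prod _ _ (hvol _ _)))
  filter_upwards [ae_ne_zero_of_contDiff_omega volume hf hT₀] with T hT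
  simpa only [isUnit_iff_isUnit_det, isUnit_iff_ne_zero, f, mul_ne_zero_iff] using hT
end
end

section
/- Fix d ≥ 1 and Boolean matrices M_1, M_2 ∈ {0,1}^{d×d²}. For Lebesgue-almost every pair (P, Q) with P, Q ∈ ℝ^{d×d²}, the d²×d² real matrix (P ∘ M_1) ⊛ (Q ∘ M_2) is invertible if and only if Det_Bool(M_1 ⊛ M_2) = 1, where M_1 ⊛ M_2 is itself a d²×d² Boolean matrix. -/
noncomputable section
open MeasureTheory Matrix

/-- The Boolean determinant of a Boolean (`{0,1}`-valued, here `ℕ`-valued) square matrix: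
`Det_Bool(B) = B_{0,0}` for `N = 1` and
`Det_Bool(B) = max_i (B_{i,0} · Det_Bool(B_{−(i,0)}))` for larger `N`. -/
def detBool : (N : ℕ) → Matrix (Fin N) (Fin N) ℕ → ℕ
  | 0, _ => 1
  | N + 1, B =>
      Finset.univ.sup fun i : Fin (N + 1) =>
        B i 0 * detBool N (B.submatrix i.succAbove Fin.succ)

theorem detBool_le_one {N : ℕ} {B : Matrix (Fin N) (Fin N) ℕ} (hB : ∀ i j, B i j ≤ 1) :
    detBool N B ≤ 1 := by
  induction N with
  | zero => simp [detBool]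
  | succ N ih =>
    simp only [detBool, Finset.sup_le_iff]
    intro i _
    exact Nat.mul_le_mul (hB i 0) (ih fun _ _ => hB _ _)

theorem detBool_ne_zero_iff_exists_injective {N : ℕ} (B : Matrix (Fin N) (Fin N) ℕ) :
    detBool N B ≠ 0 ↔ ∃ f : Fin N → Fin N, Function.Injective f ∧ ∀ k, B (f k) k ≠ 0 := by
  induction N with
  | zero => simp [detBool, Function.injective_of_subsingleton]
  | succ N ih =>
    have hsup : detBool (N + 1) B ≠ 0 ↔
        ∃ i, B i 0 ≠ 0 ∧ detBool N (B.submatrix i.succAbove Fin.succ) ≠ 0 := by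
      refine (not_congr (Finset.sup_eq_bot_iff _ _)).trans ?_
      simp
    rw [hsup]
    constructor
    · rintro ⟨i, hi, h⟩
      obtain ⟨g, hg, hgB⟩ := (ih _).1 h
      refine ⟨Fin.cons i fun k => i.succAbove (g k), ?_, ?_⟩
      · rw [Fin.cons_injective_iff]
        refine ⟨?_, Fin.succAbove_right_injective.comp hg⟩
        rintro ⟨k, hk⟩
        exact Fin.succAbove_ne _ _ hk
      · intro k
        cases k using Fin.cases with
        | zero => simpa using hi
        | succ k => simpa using hgB k
    · rintro ⟨f, hf, hfB⟩
      have hne : ∀ k : Fin N, f k.succ ≠ f 0 := fun k h => Fin.succ_ne_zero k (hf h)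
      choose g hg using fun k => Fin.exists_succAbove_eq (hne k)
      refine ⟨f 0, hfB 0, (ih _).2 ⟨g, ?_, fun k => ?_⟩⟩
      · intro a b hab
        exact Fin.succ_injective _ (hf (by rw [← hg a, ← hg b, hab]))
      · simpa [hg] using hfB k.succ

theorem detBool_ne_zero_iff_exists_perm {N : ℕ} (B : Matrix (Fin N) (Fin N) ℕ) :
    detBool N B ≠ 0 ↔ ∃ σ : Equiv.Perm (Fin N), ∀ k, B (σ k) k ≠ 0 := by
  rw [detBool_ne_zero_iff_exists_injective]
  constructor
  · rintro ⟨f, hf, h⟩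
    exact ⟨Equiv.ofBijective f (Finite.injective_iff_bijective.1 hf), h⟩
  · rintro ⟨σ, h⟩
    exact ⟨σ, σ.injective, h⟩

/-- A homogeneous function which is polynomial along lines and not identically zero is nonzero
almost everywhere. -/
theorem ae_ne_zero_of_homogeneous {E : Type*} [NormedAddCommGroup E] [NormedSpace ℝ E]
    [FiniteDimensional ℝ E] [MeasurableSpace E] [BorelSpace E] (μ : Measure E)
    [μ.IsAddHaarMeasure] {f : E → ℝ} (hf : Continuous f) {n : ℕ}
    (hom : ∀ (t : ℝ) (x : E), f (t • x) = t ^ n * f x)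
    (hpoly : ∀ x y : E, ∃ q : Polynomial ℝ, ∀ s, q.eval s = f (x + s • y))
    {w : E} (hw : f w ≠ 0) : ∀ᵐ x ∂μ, f x ≠ 0 := by
  have hmeas : MeasurableSet {x | f x ≠ 0} := (isOpen_ne_fun hf continuous_const).measurableSet
  refine ae_mem_of_ae_add_linearMap_mem (LinearMap.toSpanSingleton ℝ E w) volume μ hmeas
    fun y => ?_
  obtain ⟨q, hq⟩ := hpoly w y
  have hq0 : q ≠ 0 := by
    rintro rfl
    exact hw (by simpa using (hq 0).symm)
  have hfin : (insert 0 ((fun t : ℝ => t⁻¹) ⁻¹' {s | q.IsRoot s})).Finite :=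
    ((Polynomial.finite_setOfPred_isRoot hq0).preimage inv_injective.injOn).insert 0
  refine measure_mono_null (fun t ht => ?_) (hfin.measure_zero volume)
  by_cases h0 : t = 0
  · exact Or.inl h0
  · right
    have hline : y + t • w = t • (w + t⁻¹ • y) := by
      rw [smul_add, smul_inv_smul₀ h0, add_comm]
    have hzero : f (y + t • w) = 0 := not_not.1 ht
    rw [hline, hom] at hzero
    simpa [Polynomial.IsRoot, hq, h0] using hzero

theorem map_kr {α β : Type*} [CommSemiring α] [CommSemiring β] (φ : α →+* β) {n m : ℕ}
    (A : Matrix (Fin n) (Fin (n * m)) α) (B : Matrix (Fin m) (Fin (n * m)) α) :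
    (kr A B).map φ = kr (A.map φ) (B.map φ) := by
  ext i j
  simp [kr]

theorem kr_smul_smul {α : Type*} [CommSemiring α] {n m : ℕ} (s t : α)
    (A : Matrix (Fin n) (Fin (n * m)) α) (B : Matrix (Fin m) (Fin (n * m)) α) :
    kr (s • A) (t • B) = (s * t) • kr A B := by
  ext i j
  simp [kr, mul_mul_mul_comm]

theorem det_eq_zero_of_forall_perm {R : Type*} [CommRing R] {N : ℕ} {A : Matrix (Fin N) (Fin N) R}
    (h : ∀ σ : Equiv.Perm (Fin N), ∃ k, A (σ k) k = 0) : A.det = 0 := by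
  rw [det_apply]
  refine Finset.sum_eq_zero fun σ _ => ?_
  obtain ⟨k, hk⟩ := h σ
  have hprod : ∏ i, A (σ i) i = 0 := Finset.prod_eq_zero (Finset.mem_univ k) hk
  exact (congrArg (Equiv.Perm.sign σ • ·) hprod).trans (smul_zero _)

/-- The real determinant of the Khatri-Rao product of the two factors masked by `M1`, `M2`. -/
def maskedKrDet {n m : ℕ} (M1 : Matrix (Fin n) (Fin (n * m)) ℕ)
    (M2 : Matrix (Fin m) (Fin (n * m)) ℕ)
    (PQ : (Fin n → Fin (n * m) → ℝ) × (Fin m → Fin (n * m) → ℝ)) : ℝ :=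
  (kr (of fun i j => PQ.1 i j * (M1 i j : ℝ)) (of fun i j => PQ.2 i j * (M2 i j : ℝ))).det

section maskedKrDet

variable {n m : ℕ} (M1 : Matrix (Fin n) (Fin (n * m)) ℕ) (M2 : Matrix (Fin m) (Fin (n * m)) ℕ)

theorem continuous_maskedKrDet : Continuous (maskedKrDet M1 M2) := by
  refine Continuous.matrix_det (continuous_matrix fun i j => ?_)
  simp only [kr, of_apply]
  fun_prop

theorem maskedKrDet_smul (t : ℝ) (PQ : (Fin n → Fin (n * m) → ℝ) × (Fin m → Fin (n * m) → ℝ)) :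
    maskedKrDet M1 M2 (t • PQ) = t ^ (2 * (n * m)) * maskedKrDet M1 M2 PQ := by
  have h : kr (of fun i j => (t • PQ).1 i j * (M1 i j : ℝ))
      (of fun i j => (t • PQ).2 i j * (M2 i j : ℝ)) =
      (t * t) • kr (of fun i j => PQ.1 i j * (M1 i j : ℝ))
        (of fun i j => PQ.2 i j * (M2 i j : ℝ)) := by
    rw [← kr_smul_smul]
    congr 1 <;> ext i j <;> simp [mul_assoc]
  rw [maskedKrDet, h, det_smul, Fintype.card_fin, ← sq, ← pow_mul, maskedKrDet]

theorem exists_polynomial_eval_eq_maskedKrDet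
    (x y : (Fin n → Fin (n * m) → ℝ) × (Fin m → Fin (n * m) → ℝ)) :
    ∃ q : Polynomial ℝ, ∀ s, q.eval s = maskedKrDet M1 M2 (x + s • y) := by
  refine ⟨(kr
    (of fun i j => (Polynomial.C (x.1 i j) + Polynomial.X * Polynomial.C (y.1 i j)) *
      Polynomial.C (M1 i j : ℝ))
    (of fun i j => (Polynomial.C (x.2 i j) + Polynomial.X * Polynomial.C (y.2 i j)) *
      Polynomial.C (M2 i j : ℝ))).det, fun s => ?_⟩
  rw [← Polynomial.coe_evalRingHom, RingHom.map_det, RingHom.mapMatrix_apply, map_kr, maskedKrDet]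
  congr 2 <;> ext i j <;> simp [mul_comm s]

theorem exists_maskedKrDet_ne_zero {M1 : Matrix (Fin n) (Fin (n * m)) ℕ}
    {M2 : Matrix (Fin m) (Fin (n * m)) ℕ} {σ : Equiv.Perm (Fin (n * m))}
    (hσ : ∀ k, kr M1 M2 (σ k) k ≠ 0) : ∃ PQ, maskedKrDet M1 M2 PQ ≠ 0 := by
  have h1 : ∀ k, (M1 (σ k).divNat k : ℝ) ≠ 0 := fun k =>
    Nat.cast_ne_zero.2 (left_ne_zero_of_mul (hσ k))
  have h2 : ∀ k, (M2 (σ k).modNat k : ℝ) ≠ 0 := fun k =>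
    Nat.cast_ne_zero.2 (right_ne_zero_of_mul (hσ k))
  refine ⟨(fun i k => if i = (σ k).divNat then (M1 i k : ℝ)⁻¹ else 0,
    fun i k => if i = (σ k).modNat then (M2 i k : ℝ)⁻¹ else 0), ?_⟩
  have hperm : kr
      (of fun i k => (if i = (σ k).divNat then (M1 i k : ℝ)⁻¹ else 0) * (M1 i k : ℝ))
      (of fun i k => (if i = (σ k).modNat then (M2 i k : ℝ)⁻¹ else 0) * (M2 i k : ℝ)) =
      (σ⁻¹).permMatrix ℝ := by
    ext r k
    rw [Equiv.Perm.permMatrix, PEquiv.toMatrix_apply, Equiv.toPEquiv_apply]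
    by_cases hr : r = σ k
    · subst hr
      simp [kr, h1, h2]
    · have hne : ¬(r.divNat = (σ k).divNat ∧ r.modNat = (σ k).modNat) := fun h =>
        hr (finProdFinEquiv.symm.injective (Prod.ext h.1 h.2))
      have hr' : σ⁻¹ r ≠ k := fun h => hr (by simp [← h])
      rw [if_neg (by simpa [eq_comm] using hr')]
      rcases not_and_or.1 hne with h | h <;> simp [kr, h]
  rw [maskedKrDet, hperm, det_permutation]
  simp

end maskedKrDet

/-- Fix Boolean masks `M_1, M_2 ∈ {0,1}^{d×d²}`. For Lebesgue-almost every
pair `(P, Q)` of real `d×d²` matrices, the real matrix `(P ∘ M_1) ⊛ (Q ∘ M_2)` is invertible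
if and only if `Det_Bool(M_1 ⊛ M_2) = 1`. -/
theorem hadamard_masked_khatri_rao_invertible_iff_boolean_det (d : ℕ) (hd : 1 ≤ d)
    (M1 M2 : Matrix (Fin d) (Fin (d * d)) ℕ)
    (hM1 : ∀ i j, M1 i j ≤ 1) (hM2 : ∀ i j, M2 i j ≤ 1) :
    ∀ᵐ PQ : (Fin d → Fin (d * d) → ℝ) × (Fin d → Fin (d * d) → ℝ) ∂volume,
      (IsUnit (kr (of fun i j => PQ.1 i j * (M1 i j : ℝ))
                  (of fun i j => PQ.2 i j * (M2 i j : ℝ)))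
        ↔ detBool (d * d) (kr M1 M2) = 1) := by
  have hkr : ∀ i j, kr M1 M2 i j ≤ 1 := fun i j => Nat.mul_le_mul (hM1 _ _) (hM2 _ _)
  have hone : detBool (d * d) (kr M1 M2) = 1 ↔ detBool (d * d) (kr M1 M2) ≠ 0 := by
    have := detBool_le_one hkr
    omega
  simp_rw [hone, detBool_ne_zero_iff_exists_perm, isUnit_iff_isUnit_det, isUnit_iff_ne_zero]
  by_cases h : ∃ σ : Equiv.Perm (Fin (d * d)), ∀ k, kr M1 M2 (σ k) k ≠ 0
  · obtain ⟨σ, hσ⟩ := h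
    obtain ⟨w, hw⟩ := exists_maskedKrDet_ne_zero hσ
    have : (volume : Measure ((Fin d → Fin (d * d) → ℝ) × (Fin d → Fin (d * d) → ℝ))
        ).IsAddHaarMeasure := by
      have hpi : (volume : Measure (Fin d → Fin (d * d) → ℝ)).IsAddHaarMeasure :=
        Measure.pi.isAddHaarMeasure fun _ => volume
      exact Measure.prod.instIsAddHaarMeasure _ _
    filter_upwards [ae_ne_zero_of_homogeneous volume (continuous_maskedKrDet M1 M2)
      (maskedKrDet_smul M1 M2) (exists_polynomial_eval_eq_maskedKrDet M1 M2) hw] with PQ hPQ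
    exact iff_of_true hPQ ⟨σ, hσ⟩
  · refine Filter.Eventually.of_forall fun PQ => iff_of_false (not_not.2 ?_) h
    push Not at h
    refine det_eq_zero_of_forall_perm fun σ => ?_
    obtain ⟨k, hk⟩ := h σ
    refine ⟨k, ?_⟩
    rcases mul_eq_zero.1 hk with h0 | h0 <;> simp [kr, h0]
end
end

section
/- Let d, h ≥ 1 be integers and p, q ∈ [0,1] with p² ≥ 2qd. Then (1−p)^h · ( 2 − (1−p)^h ) ≤ (1−q)^{2dh}. -/
/-- For integers `d, h ≥ 1` and `p, q ∈ [0,1]` with `p² ≥ 2qd`, one has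
`(1−p)^h (2 − (1−p)^h) ≤ (1−q)^{2dh}`. -/
theorem bernoulli_vanishing_probability_inequality (d h : ℕ) (hd : 1 ≤ d) (hh : 1 ≤ h)
    (p q : ℝ) (hp0 : 0 ≤ p) (hp1 : p ≤ 1) (hq0 : 0 ≤ q) (hq1 : q ≤ 1)
    (hpq : 2 * q * d ≤ p ^ 2) :
    (1 - p) ^ h * (2 - (1 - p) ^ h) ≤ (1 - q) ^ (2 * d * h) := by
  have h_bern : 1 - p ^ 2 ≤ (1 - q) ^ (2 * d) := by
    have h := one_add_mul_le_pow (a := -q) (by linarith) (2 * d)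
    rw [← sub_eq_add_neg] at h
    push_cast at h
    linarith
  have h_sum : 2 - (1 - p) ^ h ≤ (1 + p) ^ h := by
    have h_add := one_add_mul_le_pow (a := p) (by linarith) h
    have h_sub := one_add_mul_le_pow (a := -p) (by linarith) h
    rw [← sub_eq_add_neg] at h_sub
    linarith
  have h_nonneg : 0 ≤ 1 - p := sub_nonneg.2 hp1
  calc (1 - p) ^ h * (2 - (1 - p) ^ h)
      ≤ (1 - p) ^ h * (1 + p) ^ h := by gcongr
    _ = (1 - p ^ 2) ^ h := by rw [← mul_pow]; ring
    _ ≤ ((1 - q) ^ (2 * d)) ^ h :=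
        pow_le_pow_left₀ (by nlinarith) h_bern h
    _ = (1 - q) ^ (2 * d * h) := (pow_mul _ _ _).symm
end
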